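/- Let f : ℝ^n → ℝ be convex, differentiable, and locally smooth, with a minimizer x* and optimal value f*. Let (x_k) be generated by x_{k+1} = x_k − α_k ∇f(x_k) with ∇f(x_k) ≠ 0 for all k, and suppose the perturbed stepsize law α_k = γ_k/(a_k L_k) holds for all k ≥ 0, where γ_k ∈ (0,1), a_k ∈ (0, γ_k], α_{−1} > 0, and L_k := ‖∇f(x_{k+1}) − ∇f(x_k)‖/‖x_{k+1} − x_k‖. Define V^p_k := ‖x_k − x*‖² + (α_{k−1}/α_k)²·‖x_{k+1} − x_k‖² and F_j := f(x_j) − f*. Then for every k ≥ 0, V^p_{k+1} − V^p_k ≤ −(α_{k−1}²/α_k² − γ_k²/a_k²)·‖x_{k+1} − x_k‖² − 2 α_k F_{k+1}. -/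

import Mathlib

open scoped RealInnerProductSpace

/-- First-order characterization of convexity: the tangent plane lies below the graph. -/
theorem ConvexOn.add_inner_gradient_le {E : Type*} [NormedAddCommGroup E]
    [InnerProductSpace ℝ E] [CompleteSpace E] {f : E → ℝ} {g z : E}
    (hf : ConvexOn ℝ Set.univ f) (hg : HasGradientAt f g z) (y : E) :
    f z + ⟪g, y - z⟫ ≤ f y := by
  have hline : ConvexOn ℝ Set.univ (f ∘ AffineMap.lineMap (k := ℝ) z y) := by
    simpa using hf.comp_affineMap (AffineMap.lineMap (k := ℝ) z y)
  have hderiv : HasDerivAt (f ∘ AffineMap.lineMap (k := ℝ) z y) ⟪g, y - z⟫ 0 := by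
    have hz : HasFDerivAt f (InnerProductSpace.toDual ℝ E g)
        (AffineMap.lineMap (k := ℝ) z y 0) := by
      simpa using hg.hasFDerivAt
    simpa using hz.comp_hasDerivAt 0 AffineMap.hasDerivAt_lineMap
  have h := hline.le_slope_of_hasDerivAt (Set.mem_univ 0) (Set.mem_univ 1) one_pos hderiv
  simp only [slope_def_field, Function.comp_apply, AffineMap.lineMap_apply_one,
    AffineMap.lineMap_apply_zero, sub_zero, div_one] at h
  linarith

/-- Lyapunov inequality for gradient descent with the perturbed stepsize law
`α_k = γ_k/(a_k L_k)`, `a_k ∈ (0, γ_k]`. Indexing convention: the paper's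
`α_{k-1}, γ_{k-1}, a_{k-1}` (including `α_{-1}`) are `α k, γ k, a k` here, so the
paper's `α_k, γ_k, a_k` are `α (k+1), γ (k+1), a (k+1)`, and the paper's
`V^p_k = ‖x_k - x*‖² + (α_{k-1}/α_k)²‖x_{k+1} - x_k‖²` is
`‖x k - x*‖² + (α k/α (k+1))²‖x (k+1) - x k‖²`. -/
theorem gd_perturbed_lyapunov
    {n : ℕ} (f : EuclideanSpace ℝ (Fin n) → ℝ)
    (f' : EuclideanSpace ℝ (Fin n) → EuclideanSpace ℝ (Fin n))
    (hdiff : ∀ z, HasGradientAt f (f' z) z)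
    (hconv : ConvexOn ℝ Set.univ f)
    (hloc : ∀ D : Set (EuclideanSpace ℝ (Fin n)), Convex ℝ D → IsCompact D →
      ∃ L > (0 : ℝ), ∀ u ∈ D, ∀ v ∈ D, ‖f' v - f' u‖ ≤ L * ‖v - u‖)
    (xs : EuclideanSpace ℝ (Fin n)) (hmin : ∀ z, f xs ≤ f z)
    (x : ℕ → EuclideanSpace ℝ (Fin n)) (α γ a : ℕ → ℝ)
    (hγ : ∀ k, γ (k + 1) ∈ Set.Ioo (0 : ℝ) 1)
    (ha : ∀ k, a (k + 1) ∈ Set.Ioc (0 : ℝ) (γ (k + 1)))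
    (hα0 : 0 < α 0)
    (hgrad : ∀ k, f' (x k) ≠ 0)
    (hstep : ∀ k, x (k + 1) = x k - α (k + 1) • f' (x k))
    (hα : ∀ k, α (k + 1) =
      γ (k + 1) / (a (k + 1) * (‖f' (x (k + 1)) - f' (x k)‖ / ‖x (k + 1) - x k‖))) :
    ∀ k : ℕ,
      (‖x (k + 1) - xs‖ ^ 2 + (α (k + 1) / α (k + 2)) ^ 2 * ‖x (k + 2) - x (k + 1)‖ ^ 2) -
        (‖x k - xs‖ ^ 2 + (α k / α (k + 1)) ^ 2 * ‖x (k + 1) - x k‖ ^ 2) ≤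
      -((α k ^ 2 / α (k + 1) ^ 2 - γ (k + 1) ^ 2 / a (k + 1) ^ 2) *
          ‖x (k + 1) - x k‖ ^ 2) -
        2 * α (k + 1) * (f (x (k + 1)) - f xs) := by
  intro k
  set A := α (k + 1) with hA
  set B := α (k + 2) with hB
  have hγk := (hγ k).1
  have hak := (ha k).1
  have hdiff₁ : x (k + 1) - x k = -(A • f' (x k)) := by
    rw [hstep k]; abel
  have hdiff₂ : x (k + 2) - x (k + 1) = -(B • f' (x (k + 1))) := by
    rw [hstep (k + 1)]; abel
  have hnorm₁ : ‖x (k + 1) - x k‖ ^ 2 = A ^ 2 * ‖f' (x k)‖ ^ 2 := by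
    rw [hdiff₁, norm_neg, norm_smul, mul_pow, Real.norm_eq_abs, sq_abs]
  have hnorm₂ : ‖x (k + 2) - x (k + 1)‖ ^ 2 = B ^ 2 * ‖f' (x (k + 1))‖ ^ 2 := by
    rw [hdiff₂, norm_neg, norm_smul, mul_pow, Real.norm_eq_abs, sq_abs]
  have hA_nonneg : 0 ≤ A := by
    rw [hA, hα k]; positivity
  -- A vanishing local smoothness estimate gives `A = 0`, and the step is trivial.
  rcases hA_nonneg.eq_or_lt with hA0 | hA_pos
  · have hx : x (k + 1) = x k := by
      rw [hstep k, ← hA, ← hA0, zero_smul, sub_zero]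
    simp [← hA0, hx]
  have hscaled : (A / B) ^ 2 * ‖x (k + 2) - x (k + 1)‖ ^ 2 ≤
      A ^ 2 * ‖f' (x (k + 1))‖ ^ 2 := by
    rw [hnorm₂]
    rcases eq_or_ne B 0 with h | h
    · rw [h, div_zero, zero_pow two_ne_zero, zero_mul]; positivity
    · apply le_of_eq; field_simp
  have hratio : γ (k + 1) ^ 2 / a (k + 1) ^ 2 * ‖x (k + 1) - x k‖ ^ 2 =
      A ^ 2 * ‖f' (x (k + 1)) - f' (x k)‖ ^ 2 := by
    have hαk := hα k
    rw [← hA] at hαk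
    have hG : ‖f' (x (k + 1)) - f' (x k)‖ ≠ 0 := by
      intro h
      rw [h] at hαk
      simp [hA_pos.ne'] at hαk
    have hD : ‖x (k + 1) - x k‖ ≠ 0 := by
      intro h
      rw [h] at hαk
      simp [hA_pos.ne'] at hαk
    rw [hαk]
    field_simp
  have hold : α k ^ 2 / A ^ 2 * ‖x (k + 1) - x k‖ ^ 2 =
      (α k / A) ^ 2 * ‖x (k + 1) - x k‖ ^ 2 := by
    rw [div_pow]
  have hdist : ‖x (k + 1) - xs‖ ^ 2 = ‖x k - xs‖ ^ 2 -
      2 * A * ⟪f' (x k), x k - xs⟫ + A ^ 2 * ‖f' (x k)‖ ^ 2 := by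
    rw [show x (k + 1) - xs = (x k - xs) - A • f' (x k) by rw [hstep k]; abel,
      norm_sub_sq_real, inner_smul_right, norm_smul, mul_pow, Real.norm_eq_abs, sq_abs,
      real_inner_comm]
    ring
  have hgap : ‖f' (x (k + 1)) - f' (x k)‖ ^ 2 = ‖f' (x (k + 1))‖ ^ 2 -
      2 * ⟪f' (x (k + 1)), f' (x k)⟫ + ‖f' (x k)‖ ^ 2 := norm_sub_sq_real _ _
  have hmin_bound := hconv.add_inner_gradient_le (hdiff (x k)) xs
  have hdescent := hconv.add_inner_gradient_le (hdiff (x (k + 1))) (x k)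
  rw [← neg_sub (x k) xs, inner_neg_right] at hmin_bound
  rw [← neg_sub (x (k + 1)) (x k), hdiff₁, neg_neg, inner_smul_right] at hdescent
  have hF : f (x (k + 1)) - f xs ≤
      ⟪f' (x k), x k - xs⟫ - A * ⟪f' (x (k + 1)), f' (x k)⟫ := by
    linarith
  have hmul := mul_le_mul_of_nonneg_left hF (by positivity : 0 ≤ 2 * A)
  rw [sub_mul, hratio, hold, hdist, hgap]
  linarith
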